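/- For every real number λ > √2, setting μ = (√2·λ − 2)/(2λ − √2), one has √2 − 2λ/(λ² − √2·λ + 1) + (λμ − 1)/(λ − μ) + (√2·λ − 1)/(λ − √2) − 1/λ ≠ 0. (Note that for λ > √2 one has λ² − √2 λ + 1 > 0, 0 < μ < λ, and λ − √2 > 0, so all denominators are nonzero.) -/

import Mathlib

/-- For every real `λ > √2`, with `μ = (√2 λ − 2)/(2λ − √2)`, one has
`√2 − 2λ/(λ² − √2 λ + 1) + (λμ − 1)/(λ − μ) + (√2 λ − 1)/(λ − √2) − 1/λ ≠ 0`. -/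
theorem stmt13 (lam μ : ℝ) (h : Real.sqrt 2 < lam)
    (hμ : μ = (Real.sqrt 2 * lam - 2) / (2 * lam - Real.sqrt 2)) :
    Real.sqrt 2 - 2 * lam / (lam ^ 2 - Real.sqrt 2 * lam + 1) + (lam * μ - 1) / (lam - μ) +
        (Real.sqrt 2 * lam - 1) / (lam - Real.sqrt 2) - 1 / lam ≠ 0 := by
  obtain ⟨t, ht, rfl⟩ : ∃ t : ℝ, 0 < t ∧ lam = √2 * (1 + t) := by
    have h0 : (0 : ℝ) < √2 := by positivity
    refine ⟨lam / √2 - 1, ?_, ?_⟩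
    · rw [sub_pos, lt_div_iff₀ h0]
      linarith
    · field_simp
      ring
  have hs : √2 ^ 2 = (2 : ℝ) := Real.sq_sqrt (by norm_num)
  have h0 : (0 : ℝ) < √2 := by positivity
  generalize √2 = s at *
  have h1 : (s * (1 + t)) ^ 2 - s * (s * (1 + t)) + 1 = 2 * t ^ 2 + 2 * t + 1 := by
    linear_combination (t ^ 2 + t) * hs
  have hm : μ = s * t / (2 * t + 1) := by
    have h2 : 2 * (s * (1 + t)) - s = s * (2 * t + 1) := by ring
    rw [hμ, h2, div_eq_div_iff (by positivity) (by positivity)]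
    linear_combination (2 * t + 1) * hs
  have h3 : (s * (1 + t) * μ - 1) / (s * (1 + t) - μ) =
      (2 * t ^ 2 - 1) / (s * (2 * t ^ 2 + 2 * t + 1)) := by
    have ha : s * (1 + t) * μ - 1 = (2 * t ^ 2 - 1) / (2 * t + 1) := by
      rw [hm]
      field_simp
      linear_combination (t ^ 2 + t) * hs
    have hb : s * (1 + t) - μ = s * (2 * t ^ 2 + 2 * t + 1) / (2 * t + 1) := by
      rw [hm]
      field_simp
      ring
    rw [ha, hb, div_div_div_cancel_right₀ (by positivity)]
  have h4 : s * (s * (1 + t)) - 1 = 2 * t + 1 := by linear_combination (1 + t) * hs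
  have h5 : s * (1 + t) - s = s * t := by ring
  rw [h1, h3, h4, h5]
  have key : s - 2 * (s * (1 + t)) / (2 * t ^ 2 + 2 * t + 1) +
      (2 * t ^ 2 - 1) / (s * (2 * t ^ 2 + 2 * t + 1)) + (2 * t + 1) / (s * t) -
      1 / (s * (1 + t)) =
      (10 * t ^ 4 + 14 * t ^ 3 + 5 * t ^ 2 + t + 1) /
        (s * (2 * t ^ 2 + 2 * t + 1) * t * (1 + t)) := by
    field_simp
    rw [hs]
    ring
  rw [key]
  positivity
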